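/- Let α ≥ 1, let σ be a maximal α-gapped repeat in a word w that is not generated by any maximal repetition of w, and let σ′ be the principal repeat of a maximal repetition of w such that σ is covered by σ′. Then ⌊log₂ p(σ)⌋ ≥ ⌊log₂ p(σ′)⌋ ≥ ⌊log₂ p(σ)⌋ − ⌈log₂ α⌉. -/

import Mathlib

variable {A : Type*}

/-- `p` is a period of the factor `w[i..j]` of the word `w` (positions are 1-based):
`1 ≤ p ≤ j - i + 1` and `w[k] = w[k+p]` whenever both positions lie in `[i, j]`. -/
def IsPeriodOf (w : ℕ → A) (i j p : ℕ) : Prop :=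
  1 ≤ p ∧ p ≤ j - i + 1 ∧ ∀ k, i ≤ k → k + p ≤ j → w k = w (k + p)

/-- The minimal period of the factor `w[i..j]`. -/
noncomputable def minPer (w : ℕ → A) (i j : ℕ) : ℕ :=
  sInf {p | IsPeriodOf w i j p}

/-- The maximality conditions for a factor `w[i..j]` of the word `w` of length `n`,
with respect to its minimal period: it cannot be extended to the left or to the right
by one letter preserving the minimal period. -/
def MaxCond (n : ℕ) (w : ℕ → A) (i j : ℕ) : Prop :=
  (1 < i → w (i - 1) ≠ w (i + minPer w i j - 1)) ∧
  (j < n → w (j + 1) ≠ w (j - minPer w i j + 1))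

/-- `w[i..j]` is a maximal repetition (run) in the word `w` of length `n`. -/
def IsMaxRepetition (n : ℕ) (w : ℕ → A) (i j : ℕ) : Prop :=
  1 ≤ i ∧ i ≤ j ∧ j ≤ n ∧ 2 * minPer w i j ≤ j - i + 1 ∧ MaxCond n w i j

/-- `w[i..j]` is a maximal subrepetition in the word `w` of length `n`:
its exponent is strictly between 1 and 2 and it satisfies the maximality conditions. -/
def IsMaxSubrepetition (n : ℕ) (w : ℕ → A) (i j : ℕ) : Prop :=
  1 ≤ i ∧ i ≤ j ∧ j ≤ n ∧ minPer w i j < j - i + 1 ∧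
    j - i + 1 < 2 * minPer w i j ∧ MaxCond n w i j

/-- A repeat in the word `w` of length `n`: a pair of equal factors
`w[b1..e1]` (left copy) and `w[b2..e2]` (right copy) with `b1 < b2`. -/
structure WordRepeat (n : ℕ) (w : ℕ → A) where
  b1 : ℕ
  e1 : ℕ
  b2 : ℕ
  e2 : ℕ
  one_le_b1 : 1 ≤ b1
  b1_le_e1 : b1 ≤ e1
  b2_le_e2 : b2 ≤ e2
  e2_le_n : e2 ≤ n
  b1_lt_b2 : b1 < b2
  len_eq : e1 - b1 = e2 - b2
  copies_eq : ∀ k, k ≤ e1 - b1 → w (b1 + k) = w (b2 + k)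

namespace WordRepeat

variable {n : ℕ} {w : ℕ → A}

/-- The period of the repeat. -/
def p (σ : WordRepeat n w) : ℕ := σ.b2 - σ.b1

/-- The length of the copies of the repeat. -/
def c (σ : WordRepeat n w) : ℕ := σ.e1 - σ.b1 + 1

/-- The repeat is maximal: its copies cannot be simultaneously extended to the left
or to the right preserving the period. (`fact σ = w[b1..e2]`.) -/
def Maximal (σ : WordRepeat n w) : Prop :=
  (1 < σ.b1 → w (σ.b1 - 1) ≠ w (σ.b2 - 1)) ∧
  (σ.e2 < n → w (σ.e1 + 1) ≠ w (σ.e2 + 1))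

/-- The repeat is overlapped: its copies are overlapped factors. -/
def Overlapped (σ : WordRepeat n w) : Prop := σ.b2 ≤ σ.e1 + 1

/-- The repeat is gapped: there is a nonempty gap between its copies. -/
def Gapped (σ : WordRepeat n w) : Prop := σ.e1 + 1 < σ.b2

/-- The repeat is `α`-gapped: it is gapped and `p(σ) ≤ α ⬝ c(σ)`. -/
def AlphaGapped (α : ℝ) (σ : WordRepeat n w) : Prop :=
  σ.Gapped ∧ (σ.p : ℝ) ≤ α * (σ.c : ℝ)

/-- `σ` is covered by `σ'`: `fact σ = w[σ.b1..σ.e2]` is contained in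
`fact σ' = w[σ'.b1..σ'.e2]` and `p(σ') < p(σ)`. -/
def CoveredBy (σ σ' : WordRepeat n w) : Prop :=
  σ'.b1 ≤ σ.b1 ∧ σ.e2 ≤ σ'.e2 ∧ σ'.p < σ.p

end WordRepeat

/-- `σ` is the principal repeat of some maximal repetition of `w`
(a reprincipal repeat). -/
def IsPrincipalOfMaxRepetition {n : ℕ} {w : ℕ → A} (σ : WordRepeat n w) : Prop :=
  ∃ i j, IsMaxRepetition n w i j ∧ σ.b1 = i ∧ σ.e1 = j - minPer w i j ∧
    σ.b2 = i + minPer w i j ∧ σ.e2 = j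

/-- `σ` is principal: it is the principal repeat of some maximal repetition or
maximal subrepetition of `w`. -/
def IsPrincipal {n : ℕ} {w : ℕ → A} (σ : WordRepeat n w) : Prop :=
  ∃ i j, (IsMaxRepetition n w i j ∨ IsMaxSubrepetition n w i j) ∧ σ.b1 = i ∧
    σ.e1 = j - minPer w i j ∧ σ.b2 = i + minPer w i j ∧ σ.e2 = j

/-- `σ` is a periodic repeat: its copies are repetitions whose minimal period
is at most `c(σ)/3`. -/
def IsPeriodicRepeat {n : ℕ} {w : ℕ → A} (σ : WordRepeat n w) : Prop :=
  3 * minPer w σ.b1 σ.e1 ≤ σ.c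

/-- The periodic repeat `σ` is represented by the maximal repetition `w[i..j]`:
both copies of `σ` extend (preserving their minimal period) to `w[i..j]`;
equivalently, `w[i..j]` is a maximal repetition whose minimal period equals the
minimal period of the copies of `σ` and which contains both copies of `σ`. -/
def RepresentedBy {n : ℕ} {w : ℕ → A} (σ : WordRepeat n w) (i j : ℕ) : Prop :=
  IsPeriodicRepeat σ ∧ IsMaxRepetition n w i j ∧
  minPer w i j = minPer w σ.b1 σ.e1 ∧ i ≤ σ.b1 ∧ σ.e2 ≤ j

/-- The periodic repeat `σ` is represented by the pair of distinct maximal repetitions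
`w[i1..j1]`, `w[i2..j2]`: the left copy of `σ` extends to `w[i1..j1]`, the right copy
extends to `w[i2..j2]`, the two repetitions being distinct (`σ` is birepresented). -/
def RepresentedByPair {n : ℕ} {w : ℕ → A} (σ : WordRepeat n w)
    (i1 j1 i2 j2 : ℕ) : Prop :=
  IsPeriodicRepeat σ ∧ IsMaxRepetition n w i1 j1 ∧ IsMaxRepetition n w i2 j2 ∧
  minPer w i1 j1 = minPer w σ.b1 σ.e1 ∧ minPer w i2 j2 = minPer w σ.b1 σ.e1 ∧
  i1 ≤ σ.b1 ∧ σ.e1 ≤ j1 ∧ i2 ≤ σ.b2 ∧ σ.e2 ≤ j2 ∧ ¬(i1 = i2 ∧ j1 = j2)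

theorem isPeriodOf_minPer (w : ℕ → A) (i j : ℕ) : IsPeriodOf w i j (minPer w i j) := by
  have h : {p | IsPeriodOf w i j p}.Nonempty := ⟨j - i + 1, by omega, le_rfl, by omega⟩
  exact Nat.sInf_mem h

theorem minPer_le {w : ℕ → A} {i j p : ℕ} (h : IsPeriodOf w i j p) : minPer w i j ≤ p :=
  Nat.sInf_le h

/-- Letters of a factor with period `q` at distance a multiple of `q` are equal. -/
theorem IsPeriodOf.eq_add_mul {w : ℕ → A} {i j q : ℕ} (h : IsPeriodOf w i j q) (m k : ℕ)
    (hk : i ≤ k) (hj : k + q * m ≤ j) : w k = w (k + q * m) := by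
  induction m with
  | zero => rfl
  | succ m ih =>
    rw [Nat.mul_succ, ← Nat.add_assoc] at hj ⊢
    rw [ih (by omega), h.2.2 (k + q * m) (by omega) hj]

/-- The `q`-periodic bi-infinite word whose letters at `0, …, q - 1` are `w i, …, w (i + q - 1)`. -/
def periodicExtension (w : ℕ → A) (i q : ℕ) (z : ℤ) : A :=
  w (i + (z % (q : ℤ)).toNat)

theorem periodicExtension_periodic (w : ℕ → A) (i q : ℕ) :
    Function.Periodic (periodicExtension w i q) (q : ℤ) := by
  intro z
  simp [periodicExtension]

theorem IsPeriodOf.periodicExtension_eq {w : ℕ → A} {i j q : ℕ} (h : IsPeriodOf w i j q) (k : ℕ)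
    (hk : i + k ≤ j) : periodicExtension w i q (k : ℤ) = w (i + k) := by
  have e : ((k : ℤ) % (q : ℤ)).toNat = k % q := by
    rw [← Int.natCast_mod, Int.toNat_natCast]
  have hdiv := Nat.mod_add_div k q
  rw [periodicExtension, e, h.eq_add_mul (k / q) (i + k % q) (by omega) (by omega), Nat.add_assoc,
    hdiv]

/-- If a factor contains two equal fragments, at distance `P`, of length at least its minimal
period, then the minimal period divides `P`. -/
theorem minPer_dvd_of_eq_fragments {w : ℕ → A} {i j b P : ℕ} (hb : i ≤ b)
    (he : b + minPer w i j + P ≤ j + 1)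
    (heq : ∀ k < minPer w i j, w (b + k) = w (b + k + P)) : minPer w i j ∣ P := by
  have hq := isPeriodOf_minPer w i j
  generalize hqdef : minPer w i j = q at *
  have hq1 : 1 ≤ q := hq.1
  set v := periodicExtension w i q with hv
  have hvq : Function.Periodic v (q : ℤ) := periodicExtension_periodic w i q
  have hvP : Function.Periodic v (P : ℤ) := by
    intro z
    obtain ⟨r, hr⟩ : ∃ r : ℕ, (r : ℤ) = (z - (b - i : ℕ)) % q :=
      ⟨_, Int.toNat_of_nonneg (Int.emod_nonneg _ (by omega))⟩
    have hrq : r < q := by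
      have := Int.emod_lt_of_pos (z - (b - i : ℕ)) (b := (q : ℤ)) (by omega)
      omega
    obtain ⟨t, ht⟩ : ∃ t : ℤ, z = ((b - i + r : ℕ) : ℤ) + t * q := by
      refine ⟨(z - (b - i : ℕ)) / q, ?_⟩
      have := Int.emod_add_mul_ediv (z - (b - i : ℕ)) q
      push_cast
      linarith
    have hper : Function.Periodic v (t * q) := hvq.int_mul t
    have h1 : v z = w (b + r) := by
      rw [ht, hper, hv, hq.periodicExtension_eq _ (by omega)]
      congr 1
      omega
    have h2 : v (z + P) = w (b + r + P) := by
      have : z + P = ((b - i + r + P : ℕ) : ℤ) + t * q := by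
        rw [ht]; push_cast; ring
      rw [this, hper, hv, hq.periodicExtension_eq _ (by omega)]
      congr 1
      omega
    rw [h1, h2, heq r hrq]
  have hvg : Function.Periodic v (Nat.gcd q P : ℤ) := by
    rw [Nat.gcd_eq_gcd_ab, mul_comm (q : ℤ), mul_comm (P : ℤ)]
    exact (hvq.int_mul _).add_period (hvP.int_mul _)
  have hgle : Nat.gcd q P ≤ q := Nat.gcd_le_left P hq1
  have hg : IsPeriodOf w i j (Nat.gcd q P) := by
    refine ⟨Nat.gcd_pos_of_pos_left P hq1, hgle.trans hq.2.1, fun k hk hkj => ?_⟩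
    have h1 := hq.periodicExtension_eq (k - i) (by omega)
    have h2 := hq.periodicExtension_eq (k - i + Nat.gcd q P) (by omega)
    have h3 := hvg ((k - i : ℕ) : ℤ)
    rw [← hv] at h1 h2
    rw [Nat.cast_add, h3, h1] at h2
    rw [show i + (k - i) = k by omega,
      show i + (k - i + Nat.gcd q P) = k + Nat.gcd q P by omega] at h2
    exact h2
  have hle : q ≤ Nat.gcd q P := hqdef.symm.trans_le (minPer_le hg)
  exact Nat.gcd_eq_left_iff_dvd.mp (le_antisymm hgle hle)

/-- If the period of a maximal repeat contained in a factor `w[i..j]` with `j ≤ n` is a multiple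
of a period of this factor, then the repeat spans the whole factor. -/
theorem WordRepeat.Maximal.span_eq {n : ℕ} {w : ℕ → A} {σ : WordRepeat n w} (hσ : σ.Maximal)
    {i j q : ℕ} (hi : 1 ≤ i) (hj : j ≤ n) (hq : IsPeriodOf w i j q) (hib : i ≤ σ.b1)
    (hej : σ.e2 ≤ j) (hdvd : q ∣ σ.p) : σ.b1 = i ∧ σ.e2 = j := by
  obtain ⟨m, hm⟩ := hdvd
  have h1 := σ.b1_le_e1
  have h2 := σ.b2_le_e2
  have h3 := σ.b1_lt_b2
  have h4 := σ.len_eq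
  unfold WordRepeat.p at hm
  constructor
  · by_contra hne
    apply hσ.1 (by omega)
    rw [hq.eq_add_mul m (σ.b1 - 1) (by omega) (by omega)]
    congr 1
    omega
  · by_contra hne
    apply hσ.2 (by omega)
    rw [hq.eq_add_mul m (σ.e1 + 1) (by omega) (by omega)]
    congr 1
    omega

/-- The copies of a maximal repeat contained in a maximal repetition which does not generate it
are shorter than the minimal period of the repetition. -/
theorem WordRepeat.Maximal.c_lt_minPer {n : ℕ} {w : ℕ → A} {σ : WordRepeat n w} (hσ : σ.Maximal)
    {i j : ℕ} (hr : IsMaxRepetition n w i j) (hib : i ≤ σ.b1) (hej : σ.e2 ≤ j)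
    (hnot : ¬(σ.b1 = i ∧ σ.e2 = j ∧ minPer w i j ∣ σ.p)) : σ.c < minPer w i j := by
  by_contra! hc
  have h1 := σ.b1_le_e1
  have h2 := σ.b2_le_e2
  have h3 := σ.b1_lt_b2
  have h4 := σ.len_eq
  have hdvd : minPer w i j ∣ σ.p := by
    unfold WordRepeat.c at hc
    refine minPer_dvd_of_eq_fragments hib (by unfold WordRepeat.p; omega) fun k hk => ?_
    rw [σ.copies_eq k (by omega)]
    congr 1
    unfold WordRepeat.p
    omega
  obtain ⟨hb, he⟩ := hσ.span_eq hr.1 hr.2.2.1 (isPeriodOf_minPer w i j) hib hej hdvd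
  exact hnot ⟨hb, he, hdvd⟩

theorem natLog_two_sub_ceil_logb_le {α : ℝ} (hα : 1 ≤ α) {p q : ℕ} (hp : p ≠ 0)
    (h : (p : ℝ) ≤ α * q) : (Nat.log 2 p : ℤ) - ⌈Real.logb 2 α⌉ ≤ (Nat.log 2 q : ℤ) := by
  obtain ⟨m, hm⟩ : ∃ m : ℕ, (m : ℤ) = ⌈Real.logb 2 α⌉ :=
    ⟨_, Int.toNat_of_nonneg (Int.ceil_nonneg (Real.logb_nonneg (by norm_num) hα))⟩
  have hαm : α ≤ 2 ^ m := by
    rw [← Real.rpow_natCast, ← Real.logb_le_iff_le_rpow (by norm_num) (by linarith)]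
    calc Real.logb 2 α ≤ (⌈Real.logb 2 α⌉ : ℝ) := Int.le_ceil _
      _ = m := by rw [← hm]; simp
  have hle : p ≤ 2 ^ m * q := by
    have : (p : ℝ) ≤ 2 ^ m * q := h.trans (by gcongr)
    exact_mod_cast this
  have hlt : p < 2 ^ (m + (Nat.log 2 q + 1)) := by
    rw [pow_add]
    exact hle.trans_lt (Nat.mul_lt_mul_of_pos_left (Nat.lt_pow_succ_log_self (by norm_num) q)
      (by positivity))
  have := Nat.log_lt_of_lt_pow hp hlt
  omega

/-- If a maximal `α`-gapped repeat `σ` which is not generated by any maximal repetition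
is covered by the principal repeat `σ'` of a maximal repetition, then
`⌊log₂ p(σ)⌋ ≥ ⌊log₂ p(σ')⌋ ≥ ⌊log₂ p(σ)⌋ - ⌈log₂ α⌉`. -/
theorem log_period_bounds_of_covered_by_principal {A : Type*} (α : ℝ) (hα : 1 ≤ α)
    (n : ℕ) (w : ℕ → A) (σ σ' : WordRepeat n w)
    (hσmax : σ.Maximal) (hσgap : σ.AlphaGapped α)
    (hnotgen : ∀ i j, IsMaxRepetition n w i j →
      ¬(σ.b1 = i ∧ σ.e2 = j ∧ minPer w i j ∣ σ.p))
    (hprin : IsPrincipalOfMaxRepetition σ')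
    (hcov : σ.CoveredBy σ') :
    Nat.log 2 σ'.p ≤ Nat.log 2 σ.p ∧
    (Nat.log 2 σ.p : ℤ) - ⌈Real.logb 2 α⌉ ≤ (Nat.log 2 σ'.p : ℤ) := by
  obtain ⟨i, j, hr, hb1, he1, hb2, he2⟩ := hprin
  have hp' : σ'.p = minPer w i j := by unfold WordRepeat.p; omega
  obtain ⟨hl, hright, hp⟩ := hcov
  have hc := hσmax.c_lt_minPer hr (by omega) (by omega) (hnotgen i j hr)
  refine ⟨Nat.log_mono_right hp.le, natLog_two_sub_ceil_logb_le hα (by omega) ?_⟩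
  refine hσgap.2.trans ?_
  rw [hp']
  gcongr
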